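/- Let f : ℝ → ℝ be C^{m+1} near 0 with f(x) = f(0) + c x^m + O(x^{m+1}) as x → 0 for some c ≠ 0 and integer m ≥ 1. Then there exist open intervals I, Ĩ containing 0 and a C¹ diffeomorphism ψ : I → Ĩ with ψ(0) = 0 such that f(ψ^{-1}(x)) = f(0) + sign(c) x^m for all x ∈ Ĩ. -/

import Mathlib

open Filter Topology Asymptotics in
theorem aux_taylor {h : ℝ → ℝ} {n : ℕ} (hh : ContDiffAt ℝ n h 0) :
    (fun x => h x - ∑ k ∈ Finset.range (n+1), ((k.factorial : ℝ)⁻¹ * x ^ k) * iteratedDeriv k h 0)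
      =o[𝓝 0] fun x => x ^ n := by
  obtain ⟨u, hu, hcd⟩ := hh.contDiffOn (m := n) le_rfl (by simp)
  obtain ⟨ε, hε, hb⟩ := Metric.mem_nhds_iff.1 hu
  have h0 : (0:ℝ) ∈ Metric.ball (0:ℝ) ε := Metric.mem_ball_self hε
  have := taylor_isLittleO (convex_ball (0:ℝ) ε) h0 (hcd.mono hb)
  rw [Metric.isOpen_ball.nhdsWithin_eq h0] at this
  simpa [taylor_within_apply, iteratedDerivWithin_of_isOpen Metric.isOpen_ball h0] using this

open Filter Topology Asymptotics in
theorem aux_g (n : ℕ) (f : ℝ → ℝ) (c : ℝ)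
    (hf : ContDiffAt ℝ ((n + 1 + 1 : ℕ) : WithTop ℕ∞) f 0)
    (hder : ∀ k, 1 ≤ k → k < n + 1 → iteratedDeriv k f 0 = 0)
    (hmth : iteratedDeriv (n+1) f 0 = ((n+1).factorial : ℝ) * c) :
    ∃ g : ℝ → ℝ, ContDiffAt ℝ 1 g 0 ∧ g 0 = c ∧ ∀ x, f x = f 0 + x ^ (n+1) * g x := by
  set d : ℝ := iteratedDeriv (n+2) f 0 / ((n+2).factorial : ℝ) with hd
  have T1 : (fun x => f x - f 0 - c * x^(n+1) - d * x^(n+2)) =o[𝓝 0] fun x => x ^ (n+2) := by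
    refine (aux_taylor hf).congr_left fun x => ?_
    rw [Finset.sum_range_succ, Finset.sum_range_succ, Finset.sum_range_succ',
      Finset.sum_eq_zero, hmth, hd]
    · have : ((n+1).factorial : ℝ) ≠ 0 := by positivity
      simp
      field_simp
      ring
    · intro k hk
      rw [hder (k+1) (by omega) (by simpa using hk)]; simp
  have hf' : ContDiffAt ℝ ((n+1 : ℕ) : WithTop ℕ∞) (deriv f) 0 := by
    refine hf.derivWithin ?_
    exact_mod_cast le_refl _
  have T2 : (fun x => deriv f x - (n+1) * c * x^n - (n+2) * d * x^(n+1)) =o[𝓝 0]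
      fun x => x ^ (n+1) := by
    refine (aux_taylor hf').congr_left fun x => ?_
    simp only [← iteratedDeriv_succ']
    rw [Finset.sum_range_succ, Finset.sum_range_succ,
      Finset.sum_eq_zero, hmth, hd]
    · have : (n.factorial : ℝ) ≠ 0 := by positivity
      simp [Nat.factorial_succ]
      field_simp
      ring
    · intro k hk
      rw [hder (k+1) (by omega) (by simpa using hk)]; simp
  let g : ℝ → ℝ := fun x => if x = 0 then c else (f x - f 0) / x^(n+1)
  let G : ℝ → ℝ := fun x => if x = 0 then d else
    (x * deriv f x - (n+1) * (f x - f 0)) / x^(n+2)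
  refine ⟨g, ?_, by simp [g], fun x => ?_⟩
  swap
  · by_cases hx : x = 0
    · simp [g, hx]
    · simp only [g, hx, if_false]; field_simp; ring
  have ev : ∀ᶠ x in 𝓝 (0:ℝ), ContDiffAt ℝ ((n + 1 + 1 : ℕ) : WithTop ℕ∞) f x :=
    hf.eventually (by simp)
  rw [contDiffAt_one_iff]
  refine ⟨fun x => ContinuousLinearMap.toSpanSingleton ℝ (G x), _, ev, ?_, ?_⟩
  · have hG : ContinuousOn G {x | ContDiffAt ℝ ((n + 1 + 1 : ℕ) : WithTop ℕ∞) f x} := by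
      intro x hx
      replace hx : ContDiffAt ℝ ((n + 1 + 1 : ℕ) : WithTop ℕ∞) f x := hx
      apply ContinuousAt.continuousWithinAt
      by_cases h0 : x = 0
      · subst h0
        rw [continuousAt_iff_punctured_nhds]
        have A := T1.tendsto_div_nhds_zero.mono_left (nhdsWithin_le_nhds (s := {0}ᶜ))
        have B := T2.tendsto_div_nhds_zero.mono_left (nhdsWithin_le_nhds (s := {0}ᶜ))
        have C := (B.sub (A.const_mul ((n:ℝ)+1))).add_const d
        have : G 0 = 0 - ((n:ℝ)+1) * 0 + d := by simp [G]
        rw [this]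
        refine C.congr' ?_
        filter_upwards [self_mem_nhdsWithin] with x hx
        have hx : x ≠ 0 := hx
        simp only [G, hx, if_false]
        field_simp
        ring
      · have e : G =ᶠ[𝓝 x] fun x => (x * deriv f x - (n+1) * (f x - f 0)) / x^(n+2) := by
          filter_upwards [isOpen_ne.mem_nhds h0] with y hy
          simp only [G, hy, if_false]
        refine ContinuousAt.congr ?_ e.symm
        have c1 : ContinuousAt f x := ContDiffAt.continuousAt hx
        have c2 : ContinuousAt (deriv f) x := (hx.derivWithin (m := ((n+1 : ℕ) : WithTop ℕ∞)) (by exact_mod_cast le_refl _)).continuousAt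
        have : x^(n+2) ≠ 0 := pow_ne_zero _ h0
        fun_prop (disch := assumption)
    exact (ContinuousLinearMap.toSpanSingletonCLE (𝕜 := ℝ) (E := ℝ)).continuous.comp_continuousOn hG
  · intro x hx
    replace hx : ContDiffAt ℝ ((n + 1 + 1 : ℕ) : WithTop ℕ∞) f x := hx
    show HasDerivAt g (G x) x
    by_cases h0 : x = 0
    · subst h0
      rw [hasDerivAt_iff_tendsto_slope]
      have A := T1.tendsto_div_nhds_zero.mono_left (nhdsWithin_le_nhds (s := {0}ᶜ))
      have C := A.add_const d
      have : G 0 = 0 + d := by simp [G]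
      rw [this]
      refine C.congr' ?_
      filter_upwards [self_mem_nhdsWithin] with x hx
      have hx : x ≠ 0 := hx
      simp only [g, slope_def_field, hx, if_false, if_true]
      field_simp
      ring
    · have e : g =ᶠ[𝓝 x] fun x => (f x - f 0) / x^(n+1) := by
        filter_upwards [isOpen_ne.mem_nhds h0] with y hy
        simp only [g, hy, if_false]
      refine HasDerivAt.congr_of_eventuallyEq ?_ e
      have d1 : HasDerivAt f (deriv f x) x :=
        (ContDiffAt.differentiableAt hx (by exact_mod_cast Nat.succ_ne_zero (n+1))).hasDerivAt
      have := (d1.sub_const (f 0)).div (hasDerivAt_pow (n+1) x) (pow_ne_zero _ h0)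
      refine this.congr_deriv ?_
      simp only [G, h0, if_false]
      push_cast
      field_simp
      ring

open Filter Topology Asymptotics in

/-- If `f` is `C^{m+1}` near `0` with `f(x) = f(0) + c x^m + O(x^{m+1})`
(`c ≠ 0`, i.e. the derivatives of order `1 ≤ k < m` vanish at `0` and `f^{(m)}(0) = m! c`),
then there are open intervals `I, Ĩ ∋ 0` and a `C¹` diffeomorphism `ψ : I → Ĩ` with
`ψ(0) = 0` such that `f(ψ⁻¹(y)) = f(0) + sign(c) y^m` on `Ĩ`. -/
theorem stmt12 (m : ℕ) (hm : 1 ≤ m) (f : ℝ → ℝ) (c : ℝ) (hc : c ≠ 0)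
    (hf : ContDiffAt ℝ (m + 1 : ℕ∞) f 0)
    (hder : ∀ k, 1 ≤ k → k < m → iteratedDeriv k f 0 = 0)
    (hmth : iteratedDeriv m f 0 = (m.factorial : ℝ) * c) :
    ∃ (a b a' b' : ℝ) (ψ φ : ℝ → ℝ),
      a < 0 ∧ 0 < b ∧ a' < 0 ∧ 0 < b' ∧
      ψ 0 = 0 ∧
      ContDiffOn ℝ 1 ψ (Set.Ioo a b) ∧
      ContDiffOn ℝ 1 φ (Set.Ioo a' b') ∧
      Set.BijOn ψ (Set.Ioo a b) (Set.Ioo a' b') ∧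
      (∀ x ∈ Set.Ioo a b, φ (ψ x) = x) ∧
      (∀ y ∈ Set.Ioo a' b', ψ (φ y) = y) ∧
      (∀ y ∈ Set.Ioo a' b', f (φ y) = f 0 + Real.sign c * y ^ m) := by
  obtain ⟨n, rfl⟩ : ∃ n, m = n + 1 := ⟨m - 1, by omega⟩
  obtain ⟨g, hg, hg0, hfg⟩ := aux_g n f c (by exact_mod_cast hf) hder hmth
  have hcp : 0 < Real.sign c * g 0 := by rw [hg0]; exact Real.sign_mul_pos_of_ne_zero c hc
  have hss : Real.sign c * Real.sign c = 1 := by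
    rcases lt_or_gt_of_ne hc with h | h
    · simp [Real.sign_of_neg h]
    · simp [Real.sign_of_pos h]
  let q : ℝ → ℝ := fun x => (Real.sign c * g x) ^ (((n+1 : ℕ) : ℝ)⁻¹)
  have hq : ContDiffAt ℝ 1 q 0 :=
    (contDiffAt_const.mul hg).rpow_const_of_ne hcp.ne'
  have hq0 : 0 < q 0 := Real.rpow_pos_of_pos hcp _
  let ψ : ℝ → ℝ := fun x => x * q x
  have hψ : ContDiffAt ℝ 1 ψ 0 := contDiffAt_id.mul hq
  have hψ0 : ψ 0 = 0 := by simp [ψ]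
  have hdψ : HasDerivAt ψ (q 0) 0 := by
    have := (hasDerivAt_id (0:ℝ)).mul (hq.differentiableAt (by simp)).hasDerivAt
    exact this.congr_deriv (by simp)
  have hstr : HasStrictDerivAt ψ (q 0) 0 := hψ.hasStrictDerivAt' hdψ (by simp)
  let e := (hstr.hasStrictFDerivAt_equiv hq0.ne').toOpenPartialHomeomorph ψ
  have he : (e : ℝ → ℝ) = ψ := rfl
  have hes : e.source ∈ 𝓝 (0:ℝ) := e.open_source.mem_nhds
    (hstr.hasStrictFDerivAt_equiv hq0.ne').mem_toOpenPartialHomeomorph_source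
  have hev : ∀ᶠ x in 𝓝 (0:ℝ), ContDiffAt ℝ 1 ψ x := hψ.eventually (by simp)
  have hdc : ContinuousAt (deriv ψ) 0 := by
    exact (hψ.derivWithin (m := 0) (by simp)).continuousAt
  have hdpos : ∀ᶠ x in 𝓝 (0:ℝ), 0 < deriv ψ x :=
    hdc.eventually (lt_mem_nhds (by rw [hdψ.deriv]; exact hq0))
  have hgpos : ∀ᶠ x in 𝓝 (0:ℝ), 0 < Real.sign c * g x :=
    (continuousAt_const.mul hg.continuousAt).eventually (lt_mem_nhds hcp)
  obtain ⟨ε, hε, hb⟩ := Metric.eventually_nhds_iff.1 ((hev.and hdpos).and (hgpos.and hes))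
  have hgood : ∀ x ∈ Set.Icc (-(ε/2)) (ε/2), (ContDiffAt ℝ 1 ψ x ∧ 0 < deriv ψ x) ∧
      0 < Real.sign c * g x ∧ x ∈ e.source := by
    intro x hx
    apply hb
    rw [Real.dist_eq, sub_zero, abs_lt]
    constructor <;> linarith [hx.1, hx.2]
  have hcont : ContinuousOn ψ (Set.Icc (-(ε/2)) (ε/2)) := fun x hx =>
    (hgood x hx).1.1.continuousAt.continuousWithinAt
  have hmono : StrictMonoOn ψ (Set.Icc (-(ε/2)) (ε/2)) :=
    strictMonoOn_of_deriv_pos (convex_Icc _ _) hcont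
      fun x hx => (hgood x (interior_subset hx)).1.2
  have hle : -(ε/2) ≤ ε/2 := by linarith
  have m0 : (0:ℝ) ∈ Set.Icc (-(ε/2)) (ε/2) := ⟨by linarith, by linarith⟩
  have ma : -(ε/2) ∈ Set.Icc (-(ε/2)) (ε/2) := ⟨by linarith, by linarith⟩
  have mb : (ε/2) ∈ Set.Icc (-(ε/2)) (ε/2) := ⟨by linarith, by linarith⟩
  have hbij : Set.BijOn ψ (Set.Ioo (-(ε/2)) (ε/2)) (Set.Ioo (ψ (-(ε/2))) (ψ (ε/2))) := by
    refine ⟨fun x hx => ?_, hmono.injOn.mono Set.Ioo_subset_Icc_self,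
      intermediate_value_Ioo hle hcont⟩
    have hx' := Set.Ioo_subset_Icc_self hx
    exact ⟨hmono ma hx' hx.1, hmono hx' mb hx.2⟩
  have hleft : ∀ x ∈ Set.Ioo (-(ε/2)) (ε/2), e.symm (ψ x) = x := fun x hx =>
    e.left_inv (hgood x (Set.Ioo_subset_Icc_self hx)).2.2
  refine ⟨-(ε/2), ε/2, ψ (-(ε/2)), ψ (ε/2), ψ, e.symm, by linarith, by linarith,
    ?_, ?_, hψ0, ?_, ?_, hbij, hleft, ?_, ?_⟩
  · rw [← hψ0]; exact hmono ma m0 (by linarith)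
  · rw [← hψ0]; exact hmono m0 mb (by linarith)
  · exact fun x hx => (hgood x (Set.Ioo_subset_Icc_self hx)).1.1.contDiffWithinAt
  · intro y hy
    obtain ⟨x, hx, rfl⟩ := hbij.surjOn hy
    have hG := hgood x (Set.Ioo_subset_Icc_self hx)
    have hl := hleft x hx
    refine (e.contDiffAt_symm_deriv (f₀' := deriv ψ x) hG.1.2.ne' (e.map_source hG.2.2) ?_ ?_).contDiffWithinAt
    · rw [he, hl]; exact (hG.1.1.differentiableAt (by simp)).hasDerivAt
    · rw [he, hl]; exact hG.1.1
  · intro y hy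
    obtain ⟨x, hx, rfl⟩ := hbij.surjOn hy
    rw [hleft x hx]
  · intro y hy
    obtain ⟨x, hx, rfl⟩ := hbij.surjOn hy
    have hG := hgood x (Set.Ioo_subset_Icc_self hx)
    rw [hleft x hx, hfg x]
    have : q x ^ (n+1) = Real.sign c * g x :=
      Real.rpow_inv_natCast_pow hG.2.1.le (by omega)
    simp only [ψ]
    rw [mul_pow, this]
    linear_combination (-(x^(n+1) * g x)) * hss
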